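/- Let pᵢ(t) = aᵢ + t·vᵢ (i = 1,…,4) be four points moving along straight lines in the plane, each with unit speed, i.e. ‖vᵢ‖ = 1 for all i. Then the function t ↦ det M(t), where M(t) is the 4×4 matrix with rows (1, xᵢ(t), yᵢ(t), xᵢ(t)² + yᵢ(t)²) and pᵢ(t) = (xᵢ(t), yᵢ(t)), is a polynomial in t of degree at most 3. -/

import Mathlib

noncomputable section

/-- Points of the Euclidean plane. -/
abbrev Pt := EuclideanSpace ℝ (Fin 2)

/-- The in-circle matrix at time `t` of four points moving as `pᵢ(t) = aᵢ + t·vᵢ`: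
row `i` is `(1, xᵢ(t), yᵢ(t), xᵢ(t)² + yᵢ(t)²)`. -/
def motionMatrix (a v : Fin 4 → Pt) (t : ℝ) : Matrix (Fin 4) (Fin 4) ℝ :=
  Matrix.of fun i j =>
    ![(1 : ℝ), a i 0 + t * v i 0, a i 1 + t * v i 1,
        (a i 0 + t * v i 0) ^ 2 + (a i 1 + t * v i 1) ^ 2] j

open Polynomial in
/-- The reduced polynomial matrix, after subtracting `t²` times the first column from the last. -/
def redMat (a v : Fin 4 → Pt) : Matrix (Fin 4) (Fin 4) (Polynomial ℝ) :=
  Matrix.of fun i j =>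
    ![(1 : Polynomial ℝ), C (v i 0) * X + C (a i 0), C (v i 1) * X + C (a i 1),
      C (2 * (a i 0 * v i 0 + a i 1 * v i 1)) * X + C (a i 0 ^ 2 + a i 1 ^ 2)] j

/-- For four points moving along straight lines at unit speed, the in-circle
determinant is a polynomial of degree at most `3` in the time `t`. -/
theorem stmt1 (a v : Fin 4 → Pt) (hv : ∀ i, ‖v i‖ = 1) :
    ∃ Q : Polynomial ℝ, Q.degree ≤ 3 ∧
      ∀ t : ℝ, (motionMatrix a v t).det = Q.eval t := by
  refine ⟨(redMat a v).det, ?_, ?_⟩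
  · refine Polynomial.degree_le_of_natDegree_le (n := 3) ?_
    rw [Matrix.det_apply]
    refine Polynomial.natDegree_sum_le_of_forall_le _ _ fun σ _ => ?_
    refine (Polynomial.natDegree_smul_le _ _).trans ?_
    refine (Polynomial.natDegree_prod_le _ _).trans ?_
    rw [Fin.sum_univ_four]
    have h0 : (redMat a v (σ 0) 0).natDegree = 0 := by simp [redMat]
    have h1 : (redMat a v (σ 1) 1).natDegree ≤ 1 := Polynomial.natDegree_linear_le
    have h2 : (redMat a v (σ 2) 2).natDegree ≤ 1 := Polynomial.natDegree_linear_le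
    have h3 : (redMat a v (σ 3) 3).natDegree ≤ 1 := Polynomial.natDegree_linear_le
    omega
  · intro t
    have hq : ∀ i, v i 0 ^ 2 + v i 1 ^ 2 = 1 := by
      intro i
      have h := EuclideanSpace.norm_sq_eq (v i)
      rw [hv i, Fin.sum_univ_two] at h
      simp only [Real.norm_eq_abs, sq_abs] at h
      linarith
    rw [← Polynomial.coe_evalRingHom, RingHom.map_det,
      ← Matrix.det_updateCol_add_smul_self _ (show (3 : Fin 4) ≠ 0 by decide) (-t ^ 2)]
    congr 1
    ext i j
    fin_cases j <;> simp [redMat, motionMatrix]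
    · ring
    · ring
    · linear_combination t ^ 2 * hq i
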